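/- Let Φ ∈ ℝ^{M×N} have unit-norm columns (‖φ_i‖₂ = 1 for all i) and satisfy the restricted isometry property of order K with constant δ ∈ (0,1). Let x ∈ ℝ^N have support T with |T| = K and let y = Φx. Then max_{t ∈ T} |⟨φ_t, y⟩| ≤ max_{t ∈ T} ( δ·‖x|_{T∖{t}}‖₂ + |x_t| ). -/

import Mathlib

open Finset

/-- The Euclidean (ℓ²) norm of a vector in ℝⁿ. -/
noncomputable def l2norm {n : ℕ} (v : Fin n → ℝ) : ℝ := Real.sqrt (∑ i, v i ^ 2)

/-- The Euclidean inner product on ℝᵐ. -/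
noncomputable def dot {m : ℕ} (u v : Fin m → ℝ) : ℝ := ∑ k, u k * v k

/-- `x` has at most `s` nonzero entries. -/
noncomputable def sparse {n : ℕ} (s : ℕ) (x : Fin n → ℝ) : Prop :=
  (Finset.univ.filter (fun i => x i ≠ 0)).card ≤ s

/-- `Φ` satisfies the restricted isometry property of order `s` with constant `δ`. -/
noncomputable def RIP {M N : ℕ} (Φ : Matrix (Fin M) (Fin N) ℝ) (s : ℕ) (δ : ℝ) : Prop :=
  ∀ x : Fin N → ℝ, sparse s x →
    (1 - δ) * l2norm x ^ 2 ≤ l2norm (Φ.mulVec x) ^ 2 ∧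
    l2norm (Φ.mulVec x) ^ 2 ≤ (1 + δ) * l2norm x ^ 2

theorem l2norm_sq_aux {n : ℕ} (v : Fin n → ℝ) : l2norm v ^ 2 = ∑ i, v i ^ 2 :=
  Real.sq_sqrt (Finset.sum_nonneg fun i _ => sq_nonneg (v i))

theorem mulVec_add_aux {M N : ℕ} (Φ : Matrix (Fin M) (Fin N) ℝ) (z : Fin N → ℝ) (t : Fin N)
    (c : ℝ) (k : Fin M) :
    Φ.mulVec (fun i => z i + if i = t then c else 0) k = Φ.mulVec z k + c * Φ k t := by
  simp [Matrix.mulVec, dotProduct, mul_add, Finset.sum_add_distrib, mul_comm]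

theorem key_aux {M N : ℕ} (K : ℕ) (Φ : Matrix (Fin M) (Fin N) ℝ)
    (hcols : ∀ i : Fin N, l2norm (fun k => Φ k i) = 1)
    (δ : ℝ) (hRIP : RIP Φ K δ) (T : Finset (Fin N)) (hTcard : T.card = K)
    (z : Fin N → ℝ) (t : Fin N) (ht : t ∈ T) (hz : ∀ i, z i ≠ 0 → i ∈ T) (hzt : z t = 0) :
    |dot (fun k => Φ k t) (Φ.mulVec z)| ≤ δ * l2norm z := by
  have hcol : ∑ k, Φ k t ^ 2 = 1 := by
    rw [← l2norm_sq_aux (fun k => Φ k t), hcols t, one_pow]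
  have main : ∀ c : ℝ,
      (1 - δ) * (l2norm z ^ 2 + c ^ 2) ≤
        l2norm (Φ.mulVec z) ^ 2 + 2 * c * dot (fun k => Φ k t) (Φ.mulVec z) + c ^ 2 ∧
      l2norm (Φ.mulVec z) ^ 2 + 2 * c * dot (fun k => Φ k t) (Φ.mulVec z) + c ^ 2 ≤
        (1 + δ) * (l2norm z ^ 2 + c ^ 2) := by
    intro c
    have h := hRIP (fun i => z i + if i = t then c else 0) (by
      unfold sparse
      rw [← hTcard]
      apply Finset.card_le_card
      intro i hi
      simp only [Finset.mem_filter, Finset.mem_univ, true_and] at hi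
      by_cases hit : i = t
      · exact hit ▸ ht
      · exact hz i (by simpa [hit] using hi))
    have e1 : l2norm (fun i => z i + if i = t then c else 0) ^ 2 = l2norm z ^ 2 + c ^ 2 := by
      rw [l2norm_sq_aux, l2norm_sq_aux]
      have : ∀ i, (z i + if i = t then c else 0) ^ 2 = z i ^ 2 + if i = t then c ^ 2 else 0 := by
        intro i
        by_cases hit : i = t
        · subst hit; simp [hzt]
        · simp [hit]
      simp [this, Finset.sum_add_distrib]
    have e2 : l2norm (Φ.mulVec (fun i => z i + if i = t then c else 0)) ^ 2 =
        l2norm (Φ.mulVec z) ^ 2 + 2 * c * dot (fun k => Φ k t) (Φ.mulVec z) + c ^ 2 := by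
      rw [l2norm_sq_aux, l2norm_sq_aux]
      unfold dot
      have hc : c ^ 2 = c ^ 2 * ∑ k, Φ k t ^ 2 := by rw [hcol, mul_one]
      rw [hc, Finset.mul_sum, Finset.mul_sum, ← Finset.sum_add_distrib, ← Finset.sum_add_distrib]
      refine Finset.sum_congr rfl fun k _ => ?_
      rw [mulVec_add_aux]
      ring
    rw [e1, e2] at h
    exact h
  have hn : 0 ≤ l2norm z := Real.sqrt_nonneg _
  rcases hn.eq_or_lt with h0 | hpos
  · have hz0 : z = 0 := by
      have h := l2norm_sq_aux z
      rw [← h0] at h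
      funext i
      have := (Finset.sum_eq_zero_iff_of_nonneg (fun i _ => sq_nonneg (z i))).1
        (by simpa using h.symm) i (Finset.mem_univ i)
      simpa using this
    rw [← h0, hz0]
    simp [dot]
  · have h1 := main (l2norm z)
    have h2 := main (-l2norm z)
    rw [abs_le]
    constructor
    · refine le_of_mul_le_mul_left ?_ hpos
      nlinarith [h1.1, h2.2]
    · refine le_of_mul_le_mul_left ?_ hpos
      nlinarith [h1.2, h2.1]

/-- inequality (20): if `Φ` has unit-norm columns and RIP of order `K`
with constant `δ ∈ (0,1)`, `x` has support `T` with `|T| = K`, and `y = Φx`, then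
`max_{t ∈ T} |⟨φ_t, y⟩| ≤ max_{t ∈ T} (δ‖x|_{T∖{t}}‖₂ + |x t|)`. -/
theorem stmt_15 {M N : ℕ} (K : ℕ) (Φ : Matrix (Fin M) (Fin N) ℝ)
    (hcols : ∀ i : Fin N, l2norm (fun k => Φ k i) = 1)
    (δ : ℝ) (hδ0 : 0 < δ) (hδ1 : δ < 1) (hRIP : RIP Φ K δ)
    (x : Fin N → ℝ) (T : Finset (Fin N))
    (hT : ∀ i, x i ≠ 0 ↔ i ∈ T) (hTcard : T.card = K)
    (y : Fin M → ℝ) (hy : y = Φ.mulVec x) :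
    (⨆ t : T, |dot (fun k => Φ k (t : Fin N)) y|) ≤
      ⨆ t : T,
        (δ * l2norm (fun i => if i ∈ T.erase (t : Fin N) then x i else 0) +
          |x (t : Fin N)|) := by
  refine ciSup_mono (Set.finite_range _).bddAbove ?_
  rintro ⟨t, ht⟩
  simp only
  set z : Fin N → ℝ := fun i => if i ∈ T.erase t then x i else 0 with hzdef
  have hk := key_aux K Φ hcols δ hRIP T hTcard z t ht
    (by
      intro i hi
      by_contra hiT
      exact hi (by simp [hzdef, hiT]))
    (by simp [hzdef])
  have hx : x = fun i => z i + if i = t then x t else 0 := by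
    funext i
    by_cases hit : i = t
    · subst hit; simp [hzdef]
    · by_cases hiT : i ∈ T
      · simp [hzdef, hit, hiT]
      · have : x i = 0 := by
          by_contra h
          exact hiT ((hT i).1 h)
        simp [hzdef, hit, hiT, this]
  have hcol : ∑ k, Φ k t ^ 2 = 1 := by
    rw [← l2norm_sq_aux (fun k => Φ k t), hcols t, one_pow]
  have hd : dot (fun k => Φ k t) y = dot (fun k => Φ k t) (Φ.mulVec z) + x t := by
    have hyk : ∀ k, y k = Φ.mulVec z k + x t * Φ k t := by
      intro k
      rw [← mulVec_add_aux, ← hx, hy]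
    have hc : x t = x t * ∑ k, Φ k t ^ 2 := by rw [hcol, mul_one]
    unfold dot
    rw [hc, Finset.mul_sum, ← Finset.sum_add_distrib]
    refine Finset.sum_congr rfl fun k _ => ?_
    rw [hyk]
    ring
  rw [hd]
  exact (abs_add_le _ _).trans (by linarith)
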